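/- arXiv:2107.09792 — 4 statements merged into one kernel-verified Lean document; each statement's English description precedes it below -/
import Mathlib

section
/- Let X and Y be open subsets of ℂ with Y bounded, let h : X → Y be a holomorphic bijection of X onto Y, and let f : X → Y be an injective map of X onto Y that is (real-)differentiable at every point of X with det(Df(z)) ≥ 0 for every z ∈ X, where Df(z) denotes the real Fréchet derivative viewed as a real 2×2 matrix. Then ∫_X ‖Df(z)‖² dz ≥ 2·vol(Y) = ∫_X ‖Dh(z)‖² dz, where vol denotes 2-dimensional Lebesgue measure and ‖·‖ the Frobenius norm. Moreover equality holds if and only if the derivative Df(z) is ℂ-linear for almost every z ∈ X. -/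
open MeasureTheory

/-- The Jacobian determinant of a real-linear map of `ℂ` in terms of its values at `1` and `i`. -/
theorem Complex.det_eq_re_mul_im_sub (T : ℂ →L[ℝ] ℂ) :
    T.det = (T 1).re * (T Complex.I).im - (T Complex.I).re * (T 1).im := by
  rw [ContinuousLinearMap.det, ← LinearMap.det_toMatrix Complex.basisOneI, Matrix.det_fin_two]
  simp [LinearMap.toMatrix_apply]

/-- The squared Frobenius norm of a real-linear map of `ℂ` is twice its determinant plus the
squared defect from `ℂ`-linearity. -/
theorem Complex.sq_norm_add_sq_norm_eq_two_mul_det_add (T : ℂ →L[ℝ] ℂ) :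
    ‖T 1‖ ^ 2 + ‖T Complex.I‖ ^ 2 =
      2 * T.det + ‖T Complex.I - Complex.I * T 1‖ ^ 2 := by
  rw [Complex.det_eq_re_mul_im_sub]
  simp only [Complex.sq_norm, Complex.normSq_apply, Complex.sub_re, Complex.sub_im,
    Complex.mul_re, Complex.mul_im, Complex.I_re, Complex.I_im]
  ring

/-- The Dirichlet energy of an injective, orientation-preserving differentiable map is twice the
area of its image plus the integral of the squared defect from `ℂ`-linearity. -/
theorem lintegral_sq_norm_fderiv_eq {X : Set ℂ} (hX : MeasurableSet X) {f : ℂ → ℂ}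
    {f' : ℂ → ℂ →L[ℝ] ℂ} (hf : ∀ z ∈ X, HasFDerivWithinAt f (f' z) X z)
    (hinj : Set.InjOn f X) (hdet : ∀ z ∈ X, 0 ≤ (f' z).det) :
    (∫⁻ z in X, ENNReal.ofReal (‖f' z 1‖ ^ 2 + ‖f' z Complex.I‖ ^ 2)) =
      2 * volume (f '' X) +
        ∫⁻ z in X, ENNReal.ofReal (‖f' z Complex.I - Complex.I * f' z 1‖ ^ 2) := by
  have hmeas := aemeasurable_ofReal_abs_det_fderivWithin volume hX hf
  rw [← lintegral_abs_det_fderiv_eq_addHaar_image volume hX hf hinj,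
    ← lintegral_const_mul'' _ hmeas, ← lintegral_add_left' (hmeas.const_mul _)]
  refine setLIntegral_congr_fun hX fun z hz => ?_
  rw [Complex.sq_norm_add_sq_norm_eq_two_mul_det_add, abs_of_nonneg (hdet z hz),
    ENNReal.ofReal_add (mul_nonneg zero_le_two (hdet z hz)) (sq_nonneg _),
    ENNReal.ofReal_mul zero_le_two, ENNReal.ofReal_ofNat]

/-- Let `X`, `Y` be open subsets of `ℂ` with `Y` bounded, `h : X → Y` a holomorphic
bijection of `X` onto `Y`, and `f : X → Y` an injective map of `X` onto `Y`,
real-differentiable at every point of `X` with nonnegative Jacobian determinant.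
Then the Dirichlet energy `∫_X ‖Df‖²` is at least `2·vol(Y) = ∫_X ‖Dh‖²`,
with equality if and only if `Df(z)` is `ℂ`-linear for almost every `z ∈ X`.
Here the squared Frobenius norm of the real derivative `T` of a map `ℂ → ℂ`
is `‖T 1‖² + ‖T i‖²`, and `T` is `ℂ`-linear iff `T i = i · T 1`. -/
theorem conformal_maps_minimize_dirichlet_energy
    (X Y : Set ℂ) (hX : IsOpen X) (hY : IsOpen Y) (hYb : Bornology.IsBounded Y)
    (h : ℂ → ℂ) (h' : ℂ → ℂ) (hh : ∀ z ∈ X, HasDerivAt h (h' z) z)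
    (hhbij : Set.BijOn h X Y)
    (f : ℂ → ℂ) (f' : ℂ → ℂ →L[ℝ] ℂ) (hf : ∀ z ∈ X, HasFDerivAt f (f' z) z)
    (hfbij : Set.BijOn f X Y)
    (hdet : ∀ z ∈ X, 0 ≤ (f' z).det) :
    2 * volume Y ≤ (∫⁻ z in X, ENNReal.ofReal (‖f' z 1‖ ^ 2 + ‖f' z Complex.I‖ ^ 2)) ∧
    2 * volume Y = (∫⁻ z in X, ENNReal.ofReal (2 * ‖h' z‖ ^ 2)) ∧
    ((∫⁻ z in X, ENNReal.ofReal (‖f' z 1‖ ^ 2 + ‖f' z Complex.I‖ ^ 2)) = 2 * volume Y ↔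
      ∀ᵐ z ∂(volume.restrict X), f' z Complex.I = Complex.I * f' z 1) := by
  have hE := lintegral_sq_norm_fderiv_eq hX.measurableSet
    (fun z hz => (hf z hz).hasFDerivWithinAt) hfbij.injOn hdet
  rw [hfbij.image_eq] at hE
  refine ⟨hE ▸ le_self_add, ?_, ?_⟩
  · let T : ℂ → ℂ →L[ℝ] ℂ := fun z =>
      (ContinuousLinearMap.toSpanSingleton ℂ (h' z)).restrictScalars ℝ
    have hT : ∀ z ∈ X, HasFDerivWithinAt h (T z) X z := fun z hz =>
      ((hh z hz).hasFDerivAt.restrictScalars ℝ).hasFDerivWithinAt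
    have hTdet : ∀ z ∈ X, 0 ≤ (T z).det := fun z _ => by
      rw [Complex.det_eq_re_mul_im_sub]
      simp only [T, ContinuousLinearMap.coe_restrictScalars',
        ContinuousLinearMap.toSpanSingleton_apply, smul_eq_mul, one_mul, Complex.mul_re,
        Complex.mul_im, Complex.I_re, Complex.I_im]
      nlinarith [sq_nonneg (h' z).re, sq_nonneg (h' z).im]
    have hEh := lintegral_sq_norm_fderiv_eq hX.measurableSet hT hhbij.injOn hTdet
    rw [hhbij.image_eq] at hEh
    simpa [T, two_mul] using hEh.symm
  · have hY_top : 2 * volume Y ≠ ⊤ := ENNReal.mul_ne_top ENNReal.ofNat_ne_top hYb.measure_lt_top.ne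
    have hmeas : AEMeasurable f' (volume.restrict X) :=
      aemeasurable_fderivWithin volume hX.measurableSet
        fun z hz => (hf z hz).hasFDerivWithinAt
    have happly : ∀ v : ℂ, AEMeasurable (fun z => f' z v) (volume.restrict X) := fun v =>
      (ContinuousLinearMap.measurable_apply v).comp_aemeasurable hmeas
    have hdefect : AEMeasurable (fun z =>
        ENNReal.ofReal (‖f' z Complex.I - Complex.I * f' z 1‖ ^ 2)) (volume.restrict X) :=
      (((happly Complex.I).sub ((happly 1).const_mul Complex.I)).norm.pow_const 2).ennreal_ofReal
    have hcancel (a : ENNReal) : 2 * volume Y + a = 2 * volume Y ↔ a = 0 := by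
      simpa using ENNReal.add_right_inj (b := a) (c := 0) hY_top
    rw [hE, hcancel, lintegral_eq_zero_iff' hdefect]
    refine Filter.eventually_congr (Filter.Eventually.of_forall fun z => ?_)
    simp [sub_eq_zero]
end

section
/- Let n ≥ 2 and let X be a real n×n matrix. Then 𝒦(X) := ‖X‖ⁿ − n^{n/2}·det X ≥ 0, i.e. n^{n/2}·det X ≤ ‖X‖ⁿ. Moreover 𝒦(X) = 0 if and only if X = λQ for some real λ ≥ 0 and some Q in the special orthogonal group SO(n). -/
open Matrix

namespace Real

theorem prod_le_arith_mean_pow {ι : Type*} [Fintype ι] [Nonempty ι] {z : ι → ℝ}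
    (hz : ∀ i, 0 ≤ z i) :
    ∏ i, z i ≤ ((∑ i, z i) / Fintype.card ι) ^ Fintype.card ι ∧
      (∏ i, z i = ((∑ i, z i) / Fintype.card ι) ^ Fintype.card ι →
        ∀ i, z i = (∑ i, z i) / Fintype.card ι) := by
  have hw : ∑ _i : ι, (Fintype.card ι : ℝ)⁻¹ = 1 := by simp
  have hsum : ∑ i, (Fintype.card ι : ℝ)⁻¹ * z i = (∑ i, z i) / Fintype.card ι := by
    rw [← Finset.mul_sum, inv_mul_eq_div]
  have hg : 0 ≤ ∏ i, z i ^ (Fintype.card ι : ℝ)⁻¹ :=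
    Finset.prod_nonneg fun i _ => rpow_nonneg (hz i) _
  have hpow : (∏ i, z i ^ (Fintype.card ι : ℝ)⁻¹) ^ Fintype.card ι = ∏ i, z i := by
    rw [← Finset.prod_pow]
    exact Finset.prod_congr rfl fun i _ => rpow_inv_natCast_pow (hz i) Fintype.card_ne_zero
  have hm : 0 ≤ (∑ i, z i) / Fintype.card ι :=
    div_nonneg (Finset.sum_nonneg fun i _ => hz i) (Nat.cast_nonneg _)
  rw [← hpow, ← hsum]
  rw [← hsum] at hm
  refine ⟨pow_le_pow_left₀ hg (geom_mean_le_arith_mean_weighted _ _ _ (fun _ _ => by positivity)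
    hw fun i _ => hz i) _, fun h i => ?_⟩
  exact (geom_mean_eq_arith_mean_weighted_iff_of_pos' _ _ _ (fun _ _ => by positivity) hw
    fun i _ => hz i).1 ((pow_left_inj₀ hg hm Fintype.card_ne_zero).1 h) i (Finset.mem_univ i)

end Real

namespace Matrix

variable {ι : Type*} [Fintype ι]

theorem PosSemidef.det_le_trace_div_card_pow [DecidableEq ι] [Nonempty ι]
    {A : Matrix ι ι ℝ} (hA : A.PosSemidef) : A.det ≤ (A.trace / Fintype.card ι) ^ Fintype.card ι := by
  simpa [hA.1.det_eq_prod_eigenvalues, hA.1.trace_eq_sum_eigenvalues] using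
    (Real.prod_le_arith_mean_pow hA.eigenvalues_nonneg).1

theorem PosSemidef.eq_smul_one_of_det_eq [DecidableEq ι] [Nonempty ι]
    {A : Matrix ι ι ℝ} (hA : A.PosSemidef)
    (h : A.det = (A.trace / Fintype.card ι) ^ Fintype.card ι) :
    A = (A.trace / Fintype.card ι) • (1 : Matrix ι ι ℝ) := by
  have key : ∀ i, hA.1.eigenvalues i = A.trace / Fintype.card ι := by
    simpa [hA.1.trace_eq_sum_eigenvalues] using
      (Real.prod_le_arith_mean_pow hA.eigenvalues_nonneg).2
        (by simpa [hA.1.det_eq_prod_eigenvalues, hA.1.trace_eq_sum_eigenvalues] using h)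
  have hdiag : diagonal (RCLike.ofReal ∘ hA.1.eigenvalues) =
      (A.trace / Fintype.card ι) • (1 : Matrix ι ι ℝ) := by
    rw [smul_one_eq_diagonal]
    congr 1
    ext i
    simp [key i]
  have hspec := hA.1.spectral_theorem
  rwa [hdiag, map_smul, map_one] at hspec

theorem trace_transpose_mul_self_eq_sum_sq (X : Matrix ι ι ℝ) :
    (Xᵀ * X).trace = ∑ i, ∑ j, X i j ^ 2 := by
  rw [Finset.sum_comm]
  simp [trace, mul_apply, sq]

/-- The scale of `X`: the root mean square of its singular values. -/
noncomputable def rmsScale (X : Matrix ι ι ℝ) : ℝ :=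
  √((Xᵀ * X).trace / Fintype.card ι)

theorem rmsScale_nonneg (X : Matrix ι ι ℝ) : 0 ≤ X.rmsScale := Real.sqrt_nonneg _

theorem posSemidef_transpose_mul_self (X : Matrix ι ι ℝ) : (Xᵀ * X).PosSemidef := by
  simpa [conjTranspose_eq_transpose_of_trivial] using posSemidef_conjTranspose_mul_self X

theorem sq_rmsScale (X : Matrix ι ι ℝ) :
    X.rmsScale ^ 2 = (Xᵀ * X).trace / Fintype.card ι := by
  refine Real.sq_sqrt (div_nonneg ?_ (Nat.cast_nonneg _))
  rw [trace_transpose_mul_self_eq_sum_sq]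
  positivity

theorem sqrt_sum_sq_eq_rmsScale_mul [Nonempty ι] (X : Matrix ι ι ℝ) :
    √(∑ i, ∑ j, X i j ^ 2) = X.rmsScale * √(Fintype.card ι) := by
  rw [rmsScale, trace_transpose_mul_self_eq_sum_sq, ← Real.sqrt_mul (by positivity),
    div_mul_cancel₀ _ (by simp)]

theorem det_le_rmsScale_pow [DecidableEq ι] [Nonempty ι] (X : Matrix ι ι ℝ) :
    X.det ≤ X.rmsScale ^ Fintype.card ι := by
  refine le_of_sq_le_sq ?_ (pow_nonneg X.rmsScale_nonneg _)
  have h := X.posSemidef_transpose_mul_self.det_le_trace_div_card_pow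
  rwa [det_mul, det_transpose, ← sq, ← sq_rmsScale, pow_right_comm] at h

theorem det_eq_rmsScale_pow_iff [DecidableEq ι] [Nonempty ι] (X : Matrix ι ι ℝ) :
    X.det = X.rmsScale ^ Fintype.card ι ↔
      ∃ (l : ℝ) (Q : Matrix ι ι ℝ), 0 ≤ l ∧ Qᵀ * Q = 1 ∧ Q.det = 1 ∧ X = l • Q := by
  constructor
  · intro h
    have hX : Xᵀ * X = X.rmsScale ^ 2 • (1 : Matrix ι ι ℝ) := by
      rw [sq_rmsScale]
      apply X.posSemidef_transpose_mul_self.eq_smul_one_of_det_eq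
      rw [det_mul, det_transpose, ← sq, h, ← sq_rmsScale, pow_right_comm]
    rcases eq_or_ne X.rmsScale 0 with h0 | h0
    · refine ⟨0, 1, le_rfl, by simp, by simp, ?_⟩
      rw [zero_smul, ← conjTranspose_mul_self_eq_zero, conjTranspose_eq_transpose_of_trivial, hX]
      simp [h0]
    · refine ⟨X.rmsScale, X.rmsScale⁻¹ • X, X.rmsScale_nonneg, ?_, ?_, ?_⟩
      · rw [transpose_smul, smul_mul_smul_comm, hX, smul_smul]
        field_simp
        simp
      · rw [det_smul, h, ← mul_pow, inv_mul_cancel₀ h0, one_pow]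
      · rw [smul_inv_smul₀ h0]
  · rintro ⟨l, Q, hl, hQ, hdet, rfl⟩
    have hscale : (l • Q).rmsScale = l := by
      rw [rmsScale, transpose_smul, smul_mul_smul_comm, hQ, trace_smul, trace_one, smul_eq_mul,
        mul_div_cancel_right₀ _ (by simp), Real.sqrt_mul_self hl]
    rw [hscale, det_smul, hdet, mul_one]

end Matrix

/-- For `n ≥ 2` and a real `n×n` matrix `X`, one has
`𝒦(X) = ‖X‖ⁿ − n^{n/2}·det X ≥ 0` (Frobenius norm, and `n^{n/2} = (√n)ⁿ`),
with `𝒦(X) = 0` if and only if `X = λ·Q` for some `λ ≥ 0` and `Q ∈ SO(n)`. -/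
theorem hadamard_conformal_inequality (n : ℕ) (hn : 2 ≤ n) (X : Matrix (Fin n) (Fin n) ℝ) :
    0 ≤ Real.sqrt (∑ i, ∑ j, (X i j) ^ 2) ^ n - Real.sqrt n ^ n * X.det ∧
    (Real.sqrt (∑ i, ∑ j, (X i j) ^ 2) ^ n - Real.sqrt n ^ n * X.det = 0 ↔
      ∃ (l : ℝ) (Q : Matrix (Fin n) (Fin n) ℝ),
        0 ≤ l ∧ Qᵀ * Q = 1 ∧ Q.det = 1 ∧ X = l • Q) := by
  have : NeZero n := ⟨by omega⟩
  have hpos : 0 < √(n : ℝ) ^ n := by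
    have : 0 < (n : ℝ) := by positivity
    positivity
  have hK : √(∑ i, ∑ j, (X i j) ^ 2) ^ n - √n ^ n * X.det =
      √n ^ n * (X.rmsScale ^ n - X.det) := by
    rw [X.sqrt_sum_sq_eq_rmsScale_mul, Fintype.card_fin]
    ring
  rw [hK]
  refine ⟨mul_nonneg hpos.le (sub_nonneg.2 (by simpa using X.det_le_rmsScale_pow)), ?_⟩
  rw [mul_eq_zero_iff_left hpos.ne', sub_eq_zero, eq_comm]
  simpa using X.det_eq_rmsScale_pow_iff
end

section
/- Let n ≥ 2, let p ≥ 1 be a real number, and let X, X₀ be real n×n matrices. Set 𝒦(X) := ‖X‖ⁿ − n^{n/2}·det X (so 𝒦 ≥ 0). Then 𝒦(X)^p − 𝒦(X₀)^p ≥ n·p·𝒦(X₀)^{p−1}·‖X₀‖^{n−2}·⟨X₀, X − X₀⟩ − n^{n/2}·p·𝒦(X₀)^{p−1}·(det X − det X₀), where ‖·‖ is the Frobenius norm and ⟨·,·⟩ the Frobenius inner product (when 𝒦(X₀) = 0 and p = 1 interpret 𝒦(X₀)^{p−1} = 1). -/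
open Matrix

/-- The nearly conformal integrand: `𝒦(X) = ‖X‖ⁿ − n^{n/2}·det X` (Frobenius norm,
`n^{n/2} = (√n)ⁿ`). -/
noncomputable def nearlyConformalK (n : ℕ) (X : Matrix (Fin n) (Fin n) ℝ) : ℝ :=
  Real.sqrt (∑ i, ∑ j, (X i j) ^ 2) ^ n - Real.sqrt n ^ n * X.det

theorem Real.rpow_sub_rpow_ge {a b p : ℝ} (ha : 0 ≤ a) (hb : 0 ≤ b) (hp : 1 ≤ p) :
    p * b ^ (p - 1) * (a - b) ≤ a ^ p - b ^ p := by
  rcases hb.eq_or_lt with rfl | hb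
  · rcases hp.eq_or_lt with rfl | hp
    · simp
    · rw [Real.zero_rpow (by linarith), Real.zero_rpow (by linarith)]
      simpa using Real.rpow_nonneg ha p
  · have h := one_add_mul_self_le_rpow_one_add (s := a / b - 1)
      (by linarith [div_nonneg ha hb.le]) hp
    rw [add_sub_cancel, Real.div_rpow ha hb.le, le_div_iff₀ (Real.rpow_pos_of_pos hb p)] at h
    have hbp : b ^ p = b ^ (p - 1) * b := by
      rw [← Real.rpow_add_one hb.ne', sub_add_cancel]
    have heq : (1 + p * (a / b - 1)) * b ^ p = b ^ p + p * b ^ (p - 1) * (a - b) := by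
      rw [hbp]
      field_simp
    linarith

theorem Matrix.PosSemidef.det_le_trace_div_pow {n : ℕ} (hn : n ≠ 0)
    {A : Matrix (Fin n) (Fin n) ℝ} (hA : A.PosSemidef) : A.det ≤ (A.trace / n) ^ n := by
  have hn' : (n : ℝ) ≠ 0 := Nat.cast_ne_zero.mpr hn
  have hnonneg := hA.eigenvalues_nonneg
  have h := Real.geom_mean_le_arith_mean_weighted Finset.univ (fun _ => (n : ℝ)⁻¹)
    hA.isHermitian.eigenvalues (fun _ _ => by positivity) (by simp [hn'])
    (fun i _ => hnonneg i)
  rw [Real.finsetProd_rpow _ _ (fun i _ => hnonneg i), ← Finset.mul_sum] at h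
  have hdet : A.det = ∏ i, hA.isHermitian.eigenvalues i := by
    simpa using hA.isHermitian.det_eq_prod_eigenvalues
  have htrace : A.trace = ∑ i, hA.isHermitian.eigenvalues i := by
    simpa using hA.isHermitian.trace_eq_sum_eigenvalues
  rw [← hdet, ← htrace] at h
  have hpow := pow_le_pow_left₀ (Real.rpow_nonneg hA.det_nonneg _) h n
  rwa [Real.rpow_inv_natCast_pow hA.det_nonneg hn, inv_mul_eq_div] at hpow

theorem nearlyConformalK_nonneg {n : ℕ} (hn : n ≠ 0) (X : Matrix (Fin n) (Fin n) ℝ) :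
    0 ≤ nearlyConformalK n X := by
  have hn' : (0 : ℝ) < n := by positivity
  have h := (posSemidef_conjTranspose_mul_self X).det_le_trace_div_pow hn
  have htrace : (Xᴴ * X).trace = ∑ i, ∑ j, X i j ^ 2 := by
    rw [Finset.sum_comm]
    simp [trace, mul_apply, sq]
  have hdet : (Xᴴ * X).det = X.det ^ 2 := by
    simp [sq]
  rw [htrace, hdet, div_pow, le_div_iff₀ (by positivity)] at h
  refine sub_nonneg.mpr (le_of_sq_le_sq ?_ (by positivity))
  rw [mul_pow, ← pow_mul, ← pow_mul, mul_comm n 2, pow_mul, pow_mul,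
    Real.sq_sqrt hn'.le, Real.sq_sqrt (by positivity)]
  linarith

theorem sum_mul_sub_le_sqrt_mul {m n : ℕ} (X X₀ : Matrix (Fin m) (Fin n) ℝ) :
    ∑ i, ∑ j, X₀ i j * (X i j - X₀ i j) ≤
      √(∑ i, ∑ j, X₀ i j ^ 2) * (√(∑ i, ∑ j, X i j ^ 2) - √(∑ i, ∑ j, X₀ i j ^ 2)) := by
  have h := Real.sum_mul_le_sqrt_mul_sqrt Finset.univ
    (fun k : Fin m × Fin n => X₀ k.1 k.2) (fun k => X k.1 k.2)
  simp only [Fintype.sum_prod_type] at h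
  have hsq := Real.mul_self_sqrt (show 0 ≤ ∑ i, ∑ j, X₀ i j ^ 2 by positivity)
  simp only [mul_sub, Finset.sum_sub_distrib, hsq, ← sq]
  linarith

/-- Subgradient estimate for the polyconvex nearly conformal energy integrand `𝒦^p`:
for `n ≥ 2`, real `p ≥ 1` and real `n×n` matrices `X`, `X₀`,
`𝒦(X)^p − 𝒦(X₀)^p ≥ n·p·𝒦(X₀)^{p−1}·‖X₀‖^{n−2}·⟨X₀, X − X₀⟩
  − n^{n/2}·p·𝒦(X₀)^{p−1}·(det X − det X₀)`.
(Real exponents `p`, `p−1`; when `𝒦(X₀) = 0` and `p = 1`, `𝒦(X₀)^{p−1} = 0^0 = 1`.) -/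
theorem nearly_conformal_subgradient (n : ℕ) (hn : 2 ≤ n) (p : ℝ) (hp : 1 ≤ p)
    (X X₀ : Matrix (Fin n) (Fin n) ℝ) :
    nearlyConformalK n X ^ p - nearlyConformalK n X₀ ^ p ≥
      n * p * nearlyConformalK n X₀ ^ (p - 1) *
          Real.sqrt (∑ i, ∑ j, (X₀ i j) ^ 2) ^ (n - 2) *
          (∑ i, ∑ j, X₀ i j * (X i j - X₀ i j))
        - Real.sqrt n ^ n * p * nearlyConformalK n X₀ ^ (p - 1) * (X.det - X₀.det) := by
  set a := √(∑ i, ∑ j, X i j ^ 2)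
  set b := √(∑ i, ∑ j, X₀ i j ^ 2)
  have hn0 : n ≠ 0 := by lia
  have hb : 0 ≤ b := Real.sqrt_nonneg _
  have hK₀ := nearlyConformalK_nonneg hn0 X₀
  have hpow := Real.rpow_sub_rpow_ge (nearlyConformalK_nonneg hn0 X) hK₀ hp
  have hnorm := Real.rpow_sub_rpow_ge (p := n) (Real.sqrt_nonneg _ : 0 ≤ a) hb
    (by exact_mod_cast (by lia : 1 ≤ n))
  rw [← Nat.cast_one, ← Nat.cast_sub (by lia)] at hnorm
  simp only [Real.rpow_natCast] at hnorm
  have hinner := mul_le_mul_of_nonneg_left (sum_mul_sub_le_sqrt_mul X X₀)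
    (by positivity : 0 ≤ n * b ^ (n - 2))
  have hb_pow : b ^ (n - 1) = b ^ (n - 2) * b := by
    rw [← pow_succ]
    congr 1
    lia
  rw [hb_pow] at hnorm
  have hdiff : n * b ^ (n - 2) * (∑ i, ∑ j, X₀ i j * (X i j - X₀ i j)) -
      √n ^ n * (X.det - X₀.det) ≤ nearlyConformalK n X - nearlyConformalK n X₀ := by
    change _ ≤ (a ^ n - √n ^ n * X.det) - (b ^ n - √n ^ n * X₀.det)
    linarith
  have h := mul_le_mul_of_nonneg_left hdiff
    (by positivity : 0 ≤ p * nearlyConformalK n X₀ ^ (p - 1))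
  linarith
end

section
/- Let 0 < r < R and 0 < r∗ < R∗ be real numbers. Define a = (R·R∗ − r·r∗)/(R² − r²) and b = (R²·r·r∗ − r²·R·R∗)/(R² − r²), and set H(t) = a·t + b/t. Then H(r) = r∗ and H(R) = R∗, and H'(t) ≥ 0 for every t ∈ [r, R] if and only if (1/2)·(R/r + r/R) ≤ R∗/r∗. -/
/-- With `a = (R·R∗ − r·r∗)/(R² − r²)`, `b = (R²·r·r∗ − r²·R·R∗)/(R² − r²)` and
`H(t) = a·t + b/t`, one has `H(r) = r∗`, `H(R) = R∗`, and `H' ≥ 0 on [r, R]` if and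
only if the Nitsche bound `(1/2)·(R/r + r/R) ≤ R∗/r∗` holds. -/
theorem nitsche_radial_solution_injectivity (r R rs Rs : ℝ)
    (hr : 0 < r) (hrR : r < R) (hrs : 0 < rs) (hRs : rs < Rs)
    (a b : ℝ) (ha : a = (R * Rs - r * rs) / (R ^ 2 - r ^ 2))
    (hb : b = (R ^ 2 * r * rs - r ^ 2 * R * Rs) / (R ^ 2 - r ^ 2))
    (H : ℝ → ℝ) (hH : ∀ t, H t = a * t + b / t) :
    H r = rs ∧ H R = Rs ∧
    ((∀ t ∈ Set.Icc r R, 0 ≤ deriv H t) ↔ (1 / 2) * (R / r + r / R) ≤ Rs / rs) := by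
  have hR : 0 < R := hr.trans hrR
  have hD : 0 < R ^ 2 - r ^ 2 := by nlinarith
  have hRs0 : 0 < Rs := hrs.trans hRs
  have ha0 : 0 < a := by
    rw [ha]
    exact div_pos (by nlinarith [mul_lt_mul hrR hRs.le hrs hR.le]) hD
  have hderiv : ∀ t, 0 < t → deriv H t = (a * t ^ 2 - b) / t ^ 2 := by
    intro t ht
    rw [funext hH]
    have h := ((hasDerivAt_id t).const_mul a).add
      ((hasDerivAt_inv ht.ne').const_mul b)
    have h' : HasDerivAt (fun t => a * t + b / t) (a * 1 + b * -(t ^ 2)⁻¹) t := by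
      simpa only [div_eq_mul_inv] using! h
    rw [h'.deriv]
    field_simp
    ring
  have hbound : (1 / 2) * (R / r + r / R) ≤ Rs / rs ↔
      rs * (R ^ 2 + r ^ 2) ≤ 2 * r * R * Rs := by
    have h : (1 / 2) * (R / r + r / R) = (R ^ 2 + r ^ 2) / (2 * r * R) := by
      field_simp
    rw [h, div_le_div_iff₀ (by positivity) hrs]
    constructor <;> intro h <;> linarith
  have hinner : a * r ^ 2 - b =
      r * (2 * r * R * Rs - rs * (R ^ 2 + r ^ 2)) / (R ^ 2 - r ^ 2) := by
    rw [ha, hb]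
    field_simp
    ring
  have hsign : 0 ≤ a * r ^ 2 - b ↔ rs * (R ^ 2 + r ^ 2) ≤ 2 * r * R * Rs := by
    rw [hinner, le_div_iff₀ hD, zero_mul, mul_nonneg_iff_of_pos_left hr, sub_nonneg]
  refine ⟨?_, ?_, ?_⟩
  · rw [hH, ha, hb]
    field_simp
    ring
  · rw [hH, ha, hb]
    field_simp
    ring
  · rw [hbound, ← hsign]
    constructor
    · intro h
      have h0 := h r ⟨le_rfl, hrR.le⟩
      rwa [hderiv r hr, le_div_iff₀ (by positivity), zero_mul] at h0
    · rintro h t ⟨hrt, -⟩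
      rw [hderiv t (hr.trans_le hrt)]
      have hsq : a * r ^ 2 ≤ a * t ^ 2 := by gcongr
      exact div_nonneg (by linarith) (sq_nonneg t)
end
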